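/- Let f be an arbitrary probability mass function on Z/pZ, let h_1, ..., h_n be △-regular pmfs, and s_1, ..., s_{2m} be □-regular pmfs. Then the convolution f ⋆ h_1 ⋆ ... ⋆ h_n ⋆ s_1 ⋆ ... ⋆ s_{2m} is majorized by f^+ ⋆ h_1^* ⋆ ... ⋆ h_n^* ⋆ s_1^+ ⋆ s_2^- ⋆ ... ⋆ s_{2m-1}^+ ⋆ s_{2m}^-. -/

import Mathlib

open scoped BigOperators ENNReal Classical

namespace Paper

variable {p : ℕ}

/-- Convolution of two functions on `ZMod p`. -/
noncomputable def conv [NeZero p] (f g : ZMod p → ℝ) : ZMod p → ℝ :=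
  fun k => ∑ i : ZMod p, f i * g (k - i)

/-- Iterated convolution of a list of functions (the delta mass at `0` is the
convolution identity used as the base of the fold). -/
noncomputable def convList [NeZero p] (l : List (ZMod p → ℝ)) : ZMod p → ℝ :=
  l.foldr conv (fun k => if k = 0 then 1 else 0)

/-- The enumeration `0, +1, -1, +2, -2, ...` of `ZMod p`. -/
def plusSeq (p : ℕ) (n : ℕ) : ZMod p :=
  if n % 2 = 0 then -((n / 2 : ℕ) : ZMod p) else (((n + 1) / 2 : ℕ) : ZMod p)

/-- The enumeration `0, -1, +1, -2, +2, ...` of `ZMod p`. -/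
def minusSeq (p : ℕ) (n : ℕ) : ZMod p := -(plusSeq p n)

/-- `fp` is the `+`-rearrangement of `f`: a permutation of the values of `f` that is
nonincreasing along the ordering `0, +1, -1, +2, -2, ...`. -/
def IsPlusRearr (f fp : ZMod p → ℝ) : Prop :=
  (∃ σ : Equiv.Perm (ZMod p), fp = f ∘ σ) ∧
    ∀ n : ℕ, n + 1 < p → fp (plusSeq p (n + 1)) ≤ fp (plusSeq p n)

/-- `fm` is the `-`-rearrangement of `f`: a permutation of the values of `f` that is
nonincreasing along the ordering `0, -1, +1, -2, +2, ...`. -/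
def IsMinusRearr (f fm : ZMod p → ℝ) : Prop :=
  (∃ σ : Equiv.Perm (ZMod p), fm = f ∘ σ) ∧
    ∀ n : ℕ, n + 1 < p → fm (minusSeq p (n + 1)) ≤ fm (minusSeq p n)

/-- `f` is `△`-regular: its `+`-rearrangement is symmetric (so `f⁺ = f⁻`). -/
def TriangleRegular (f : ZMod p → ℝ) : Prop :=
  ∃ fp, IsPlusRearr f fp ∧ ∀ z, fp (-z) = fp z

/-- `f` is `□`-regular: `f⁺(z+1) = f⁻(z)` for all `z`. -/
def SquareRegular (f : ZMod p → ℝ) : Prop :=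
  ∃ fp fm, IsPlusRearr f fp ∧ IsMinusRearr f fm ∧ ∀ z, fp (z + 1) = fm z

/-- probability mass function on `ZMod p`. -/
def IsPMF [NeZero p] (f : ZMod p → ℝ) : Prop :=
  (∀ i, 0 ≤ f i) ∧ ∑ i : ZMod p, f i = 1

/-- Weak majorization: for every `r`, the sum of the `r` largest values of `f` is at most
the sum of the `r` largest values of `g` (expressed via subsets of each cardinality). -/
def WeakMaj [NeZero p] (f g : ZMod p → ℝ) : Prop :=
  ∀ s : Finset (ZMod p), ∃ t : Finset (ZMod p),
    t.card = s.card ∧ ∑ i ∈ s, f i ≤ ∑ i ∈ t, g i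

/-- Majorization: weak majorization together with equality of total sums. -/
def Maj [NeZero p] (f g : ZMod p → ℝ) : Prop :=
  WeakMaj f g ∧ ∑ i : ZMod p, f i = ∑ i : ZMod p, g i

/-- `f` and `g` are shape-equivalent: there is a single ordering of the index set along
which both are nonincreasing. -/
def ShapeEquiv [NeZero p] (f g : ZMod p → ℝ) : Prop :=
  ∃ e : Fin p ≃ ZMod p, (∀ m n : Fin p, m ≤ n → f (e n) ≤ f (e m)) ∧
    (∀ m n : Fin p, m ≤ n → g (e n) ≤ g (e m))

/-- Rényi entropy of order `α ∈ [0,∞]` of a pmf on `ZMod p`. -/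
noncomputable def renyi [NeZero p] (α : ℝ≥0∞) (f : ZMod p → ℝ) : ℝ :=
  if α = 0 then Real.log ((Finset.univ.filter (fun i => f i ≠ 0)).card)
  else if α = 1 then ∑ i : ZMod p, Real.negMulLog (f i)
  else if α = ⊤ then -Real.log (⨆ i : ZMod p, f i)
  else (1 - α.toReal)⁻¹ * Real.log (∑ i : ZMod p, f i ^ α.toReal)

/-- The number of representations `x = a + b` with `a ∈ A` and `b ∈ B`. -/
noncomputable def rep (A B : Finset (ZMod p)) (x : ZMod p) : ℕ :=
  (A.filter fun a => x - a ∈ B).card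

lemma rep_comm (A B : Finset (ZMod p)) (x : ZMod p) : rep A B x = rep B A x := by
  unfold rep
  refine Finset.card_nbij' (fun a => x - a) (fun a => x - a) ?_ ?_ ?_ ?_ <;> intro a <;> simp
  · exact fun h₁ h₂ => ⟨h₂, h₁⟩
  · exact fun h₁ h₂ => ⟨h₂, h₁⟩

lemma rep_union_left {A A' : Finset (ZMod p)} (h : Disjoint A A') (B : Finset (ZMod p))
    (x : ZMod p) : rep (A ∪ A') B x = rep A B x + rep A' B x := by
  unfold rep
  rw [Finset.filter_union, Finset.card_union_of_disjoint (Finset.disjoint_filter_filter h)]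

lemma rep_union_right (A : Finset (ZMod p)) {B B' : Finset (ZMod p)} (h : Disjoint B B')
    (x : ZMod p) : rep A (B ∪ B') x = rep A B x + rep A B' x := by
  rw [rep_comm, rep_union_left h, rep_comm B, rep_comm B']

lemma rep_mono_right (A : Finset (ZMod p)) {B B' : Finset (ZMod p)} (h : B ⊆ B') (x : ZMod p) :
    rep A B x ≤ rep A B' x :=
  Finset.card_le_card (Finset.monotone_filter_right _ fun _ _ ha => h ha)

lemma rep_le_left (A B : Finset (ZMod p)) (x : ZMod p) : rep A B x ≤ A.card :=
  Finset.card_filter_le _ _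

lemma rep_le_right (A B : Finset (ZMod p)) (x : ZMod p) : rep A B x ≤ B.card :=
  rep_comm A B x ▸ rep_le_left B A x

lemma rep_map_add_right (A B : Finset (ZMod p)) (e x : ZMod p) :
    rep A (B.map (addRightEmbedding e)) x = rep A B (x - e) := by
  unfold rep
  congr 1
  ext a
  simp only [Finset.mem_filter, Finset.mem_map, addRightEmbedding_apply, and_congr_right_iff]
  intro _
  constructor
  · rintro ⟨b, hb, h⟩
    rwa [show x - e - a = b by rw [← add_sub_cancel_right b e, h]; ring]
  · exact fun h => ⟨_, h, by ring⟩

lemma sum_rep [NeZero p] (A B : Finset (ZMod p)) : ∑ x, rep A B x = A.card * B.card := by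
  simp_rw [rep, Finset.card_filter]
  rw [Finset.sum_comm, ← smul_eq_mul, ← Finset.sum_const]
  refine Finset.sum_congr rfl fun a _ => ?_
  exact (Equiv.sum_comp (Equiv.subRight a) fun y => if y ∈ B then 1 else 0).trans (by simp)

/-- Dyson's e-transform splits the representation function. -/
lemma rep_eq_add_transform (A B : Finset (ZMod p)) (x : ZMod p) :
    rep A B x = rep (A ∪ B) (A ∩ B) x + rep (A \ B) (B \ A) x := by
  have hB : B = (A ∩ B) ∪ (B \ A) := by ext; simp; tauto
  have hA : A = (A ∩ B) ∪ (A \ B) := by ext; simp; tauto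
  have hBd : Disjoint (A ∩ B) (B \ A) := by
    rw [Finset.disjoint_left]; intro a; simp; tauto
  have hAd : Disjoint (A ∩ B) (A \ B) := by
    rw [Finset.disjoint_left]; intro a; simp; tauto
  have hU : A ∪ B = A ∪ (B \ A) := by simp
  have hUd : Disjoint A (B \ A) := Finset.disjoint_sdiff
  have h₁ : rep A B x = rep A (A ∩ B) x + rep A (B \ A) x := by
    rw [← rep_union_right A hBd, ← hB]
  have h₂ : rep A (B \ A) x = rep (A ∩ B) (B \ A) x + rep (A \ B) (B \ A) x := by
    rw [← rep_union_left hAd, ← hA]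
  rw [h₁, h₂, hU, rep_union_left hUd, rep_comm (B \ A) (A ∩ B)]
  ring

lemma eq_univ_of_add_mem [Fact p.Prime] {A : Finset (ZMod p)} (hA : A.Nonempty)
    {d : ZMod p} (hd : d ≠ 0) (h : ∀ a ∈ A, a + d ∈ A) : A = Finset.univ := by
  obtain ⟨a, ha⟩ := hA
  have key : ∀ n : ℕ, a + n * d ∈ A := by
    intro n
    induction n with
    | zero => simpa using ha
    | succ n ih => simpa [add_mul, add_assoc] using h _ ih
  refine Finset.eq_univ_of_forall fun x => ?_
  have := key ((x - a) / d).val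
  rwa [ZMod.natCast_zmod_val, div_mul_cancel₀ _ hd, add_sub_cancel] at this

lemma exists_translate_inter [Fact p.Prime] {A B : Finset (ZMod p)} (hA : A.Nonempty)
    (hA' : A ≠ Finset.univ) (hB : 1 < B.card) :
    ∃ e, 0 < (A ∩ B.map (addRightEmbedding e)).card ∧
      (A ∩ B.map (addRightEmbedding e)).card < B.card := by
  by_contra! hcon
  obtain ⟨b, hb, b', hb', hne⟩ := Finset.one_lt_card.mp hB
  refine hA' (eq_univ_of_add_mem hA (sub_ne_zero.mpr hne.symm) fun a ha => ?_)
  have hmem : a ∈ A ∩ B.map (addRightEmbedding (a - b)) := by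
    simp only [Finset.mem_inter, Finset.mem_map, addRightEmbedding_apply]
    exact ⟨ha, b, hb, by ring⟩
  have hle := hcon (a - b) (Finset.card_pos.mpr ⟨a, hmem⟩)
  rw [← Finset.card_map (addRightEmbedding (a - b))] at hle
  have heq := Finset.eq_of_subset_of_card_le Finset.inter_subset_right hle
  have : b' + (a - b) ∈ A ∩ B.map (addRightEmbedding (a - b)) := by
    rw [heq]; exact Finset.mem_map.mpr ⟨b', hb', rfl⟩
  have := (Finset.mem_inter.mp this).1
  rwa [show a + (b' - b) = b' + (a - b) by ring]

lemma pollard_of_card_add_le [Fact p.Prime] (n : ℕ) : ∀ (A B : Finset (ZMod p)) (t : ℕ),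
    B.card = n → t ≤ A.card → t ≤ B.card → A.card + B.card ≤ p + t →
      t * (A.card + B.card - t) ≤ ∑ x, min t (rep A B x) := by
  induction n using Nat.strong_induction_on with
  | _ n ih =>
  intro A B t hn htA htB hp
  rcases htB.eq_or_lt with htB | htB
  · have : ∀ x, min t (rep A B x) = rep A B x := fun x =>
      min_eq_right (htB ▸ rep_le_right A B x)
    simp_rw [this, sum_rep, htB]
    simp [mul_comm]
  rcases Nat.eq_zero_or_pos t with rfl | ht
  · simp
  have hA : A.Nonempty := Finset.card_pos.mp (by omega)
  have hA' : A ≠ Finset.univ := by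
    rintro rfl
    rw [Finset.card_univ, ZMod.card] at hp
    omega
  obtain ⟨e, he₀, he₁⟩ := exists_translate_inter hA hA' (by omega : 1 < B.card)
  set C := B.map (addRightEmbedding e) with hC
  have hCB : C.card = B.card := Finset.card_map _
  have hshift : ∑ x, min t (rep A B x) = ∑ x, min t (rep A C x) := by
    simp_rw [hC, rep_map_add_right]
    exact (Equiv.sum_comp (Equiv.subRight e) (fun y => min t (rep A B y))).symm
  rw [hshift, ← hCB]
  have hcard := Finset.card_union_add_card_inter A C
  have hcA := Finset.card_sdiff_add_card_inter A C
  have hcC := Finset.card_sdiff_add_card_inter C A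
  rw [Finset.inter_comm C A] at hcC
  rcases le_or_gt t (A ∩ C).card with hi | hi
  · have := ih _ (by omega) (A ∪ C) (A ∩ C) t rfl (by omega) hi (by omega)
    rw [hcard] at this
    refine this.trans (Finset.sum_le_sum fun x _ => ?_)
    have := rep_eq_add_transform A C x
    omega
  · set i := (A ∩ C).card
    have h₂ := ih _ (by omega) (A \ C) (C \ A) (t - i) rfl (by omega) (by omega) (by omega)
    have h₁ := sum_rep (A ∪ C) (A ∩ C)
    have h₃ : ∑ x, rep (A ∪ C) (A ∩ C) x + ∑ x, min (t - i) (rep (A \ C) (C \ A) x)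
        ≤ ∑ x, min t (rep A C x) := by
      rw [← Finset.sum_add_distrib]
      refine Finset.sum_le_sum fun x _ => ?_
      have := rep_eq_add_transform A C x
      have := rep_le_right (A ∪ C) (A ∩ C) x
      omega
    refine le_trans ?_ h₃
    rw [h₁]
    refine le_trans ?_ (Nat.add_le_add_left h₂ _)
    obtain ⟨u, hu⟩ : ∃ u, t = i + u := ⟨t - i, by omega⟩
    obtain ⟨v, hv⟩ : ∃ v, A.card = i + u + v := ⟨A.card - i - u, by omega⟩
    obtain ⟨w, hw⟩ : ∃ w, C.card = i + u + w := ⟨C.card - i - u, by omega⟩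
    rw [show (A ∪ C).card = i + 2 * u + v + w by omega,
      show t - i = u by omega, show A.card + C.card - t = i + u + v + w by omega,
      show (A \ C).card + (C \ A).card - u = u + v + w by omega, hu]
    change (i + u) * (i + u + v + w) ≤ (i + 2 * u + v + w) * i + u * (u + v + w)
    nlinarith

/-- Pollard's theorem. -/
lemma pollard [Fact p.Prime] (A B : Finset (ZMod p)) (t : ℕ) (htA : t ≤ A.card)
    (htB : t ≤ B.card) :
    t * min p (A.card + B.card - t) ≤ ∑ x, min t (rep A B x) := by
  rcases le_or_gt (A.card + B.card) (p + t) with h | h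
  · exact (Nat.mul_le_mul_left t (min_le_right _ _)).trans
      (pollard_of_card_add_le _ A B t rfl htA htB h)
  · have hAp : A.card ≤ p := (Finset.card_le_univ A).trans_eq (ZMod.card p)
    obtain ⟨B', hB', hcard⟩ := Finset.exists_subset_card_eq
      (show p + t - A.card ≤ B.card by omega)
    have := pollard_of_card_add_le _ A B' t rfl htA (by omega) (by omega)
    rw [hcard, show A.card + (p + t - A.card) - t = p by omega] at this
    refine (Nat.mul_le_mul_left t (min_le_left _ _)).trans (this.trans ?_)
    exact Finset.sum_le_sum fun x _ => min_le_min_left _ (rep_mono_right A hB' x)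

/-- The arithmetic progression `α, α + 1, ..., α + (a - 1)` in `ZMod p`. -/
noncomputable def ivl (α : ZMod p) (a : ℕ) : Finset (ZMod p) :=
  (Finset.range a).image fun i : ℕ => α + i

lemma natCast_injOn_range [NeZero p] {a : ℕ} (ha : a ≤ p) {i j : ℕ} (hi : i < a) (hj : j < a)
    (h : (i : ZMod p) = j) : i = j := by
  have := congrArg ZMod.val h
  rwa [ZMod.val_natCast_of_lt (by omega), ZMod.val_natCast_of_lt (by omega)] at this

lemma card_ivl [NeZero p] (α : ZMod p) {a : ℕ} (ha : a ≤ p) : (ivl α a).card = a := by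
  rw [ivl, Finset.card_image_of_injOn, Finset.card_range]
  intro i hi j hj h
  exact natCast_injOn_range ha (by simpa using hi) (by simpa using hj) (add_left_cancel h)

lemma rep_ivl [NeZero p] (α β : ZMod p) {a b : ℕ} (ha : a ≤ p) (hb : b ≤ p) (x : ZMod p) :
    rep (ivl α a) (ivl β b) x = ((Finset.range a ×ˢ Finset.range b).filter
      fun q : ℕ × ℕ => α + β + (q.1 + q.2 : ℕ) = x).card := by
  symm
  refine Finset.card_bij (fun q _ => α + (q.1 : ZMod p)) ?_ ?_ ?_
  · rintro ⟨i, j⟩ h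
    simp only [Finset.mem_filter, Finset.mem_product, Finset.mem_range, ivl,
      Finset.mem_image] at h ⊢
    exact ⟨⟨i, h.1.1, rfl⟩, j, h.1.2, by rw [← h.2]; push_cast; ring⟩
  · rintro ⟨i, j⟩ h ⟨i', j'⟩ h' heq
    simp only [Finset.mem_filter, Finset.mem_product, Finset.mem_range] at h h' heq
    have hi := natCast_injOn_range ha h.1.1 h'.1.1 (add_left_cancel heq)
    subst hi
    have hj : (j : ZMod p) = j' := by
      have := h.2.trans h'.2.symm
      push_cast at this
      exact add_left_cancel (add_left_cancel this)
    rw [natCast_injOn_range hb h.1.2 h'.1.2 hj]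
  · intro y hy
    simp only [Finset.mem_filter, Finset.mem_range, ivl, Finset.mem_image] at hy
    obtain ⟨⟨i, hi, rfl⟩, j, hj, h⟩ := hy
    refine ⟨(i, j), ?_, rfl⟩
    simp only [Finset.mem_filter, Finset.mem_product, Finset.mem_range]
    exact ⟨⟨hi, hj⟩, by push_cast; linear_combination h⟩

/-- Intervals attain equality in Pollard's theorem. -/
lemma sum_min_rep_ivl_le [NeZero p] (α β : ZMod p) {a b t : ℕ} (ha : a ≤ p) (hb : b ≤ p)
    (hta : t ≤ a) (htb : t ≤ b) :
    ∑ x, min t (rep (ivl α a) (ivl β b) x) ≤ t * min p (a + b - t) := by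
  rw [← Nat.mul_min_mul_left]
  refine le_min ?_ ?_
  · refine (Finset.sum_le_sum fun x _ => min_le_left _ _).trans ?_
    simp [ZMod.card, mul_comm]
  set C := (Finset.range a ×ˢ Finset.range b) \ (Finset.Ico t a ×ˢ Finset.range (b - t)) with hC
  have hcard : C.card = t * (a + b - t) := by
    rw [hC, Finset.card_sdiff_of_subset]
    · simp only [Finset.card_product, Finset.card_range, Nat.card_Ico]
      obtain ⟨u, rfl⟩ := Nat.exists_eq_add_of_le hta
      obtain ⟨v, rfl⟩ := Nat.exists_eq_add_of_le htb
      rw [show t + u - t = u by omega, show t + v - t = v by omega,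
        show t + u + (t + v) - t = t + u + v by omega]
      exact Nat.sub_eq_of_eq_add (by ring)
    · refine Finset.product_subset_product ?_ ?_ <;> intro i <;>
        simp only [Finset.mem_Ico, Finset.mem_range] <;> omega
  rw [← hcard, Finset.card_eq_sum_card_fiberwise (s := C) (t := Finset.univ)
    (f := fun q : ℕ × ℕ => α + β + (q.1 + q.2 : ℕ)) (by simp)]
  refine Finset.sum_le_sum fun x _ => ?_
  rw [rep_ivl α β ha hb]
  by_cases hsub : ∀ q ∈ Finset.range a ×ˢ Finset.range b,
      α + β + (q.1 + q.2 : ℕ) = x → q ∈ C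
  · refine (min_le_right _ _).trans (Finset.card_le_card fun q hq => ?_)
    rw [Finset.mem_filter] at hq ⊢
    exact ⟨hsub q hq.1 hq.2, hq.2⟩
  · push Not at hsub
    obtain ⟨⟨i, j⟩, hq, hx, hqC⟩ := hsub
    simp only [hC, Finset.mem_sdiff, Finset.mem_product, Finset.mem_range, Finset.mem_Ico]
      at hq hqC
    refine (min_le_left _ _).trans ?_
    conv_lhs => rw [← Finset.card_range t]
    set M := min i (b - 1 - j) with hM
    refine Finset.card_le_card_of_injOn (fun s => (i - (M - s), j + (M - s))) ?_ ?_
    · intro s hs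
      rw [Finset.mem_coe, Finset.mem_range] at hs
      simp only [Finset.coe_filter, Set.mem_ofPred_eq, hC, Finset.mem_sdiff, Finset.mem_product,
        Finset.mem_range, Finset.mem_Ico]
      refine ⟨by omega, ?_⟩
      rw [← hx, show i - (M - s) + (j + (M - s)) = i + j by omega]
    · intro s hs s' hs' h
      simp only [Finset.coe_range, Set.mem_Iio, Prod.mk.injEq] at hs hs' h
      omega

/-- `f` is nonincreasing along `0, +1, -1, +2, -2, ...`. -/
def PlusAntitone (f : ZMod p → ℝ) : Prop :=
  ∀ n : ℕ, n + 1 < p → f (plusSeq p (n + 1)) ≤ f (plusSeq p n)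

/-- The integer representative of `plusSeq p n` closest to `0`. -/
def plusInt (n : ℕ) : ℤ := if n % 2 = 0 then -((n / 2 : ℕ) : ℤ) else ((n + 1) / 2 : ℕ)

lemma plusSeq_eq_intCast (n : ℕ) : plusSeq p n = (plusInt n : ℤ) := by
  unfold plusSeq plusInt
  split_ifs <;> simp only [Int.cast_neg, Int.cast_natCast]

lemma intCast_eq_iff (u v : ℤ) : (u : ZMod p) = v ↔ ∃ q : ℤ, v = u + p * q := by
  rw [ZMod.intCast_eq_intCast_iff_dvd_sub]
  exact exists_congr fun q => by constructor <;> intro h <;> linarith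

lemma plusSeq_injOn {i j : ℕ} (hi : i < p) (hj : j < p) (h : plusSeq p i = plusSeq p j) :
    i = j := by
  rw [plusSeq_eq_intCast, plusSeq_eq_intCast, intCast_eq_iff] at h
  obtain ⟨q, hq⟩ := h
  have h₁ : |plusInt j - plusInt i| < p := by
    unfold plusInt; rw [abs_lt]; split_ifs <;> omega
  have h₂ : plusInt j - plusInt i = 0 :=
    Int.eq_zero_of_abs_lt_dvd ⟨q, by linarith⟩ h₁
  unfold plusInt at h₂
  split_ifs at h₂ <;> omega

/-- The initial segment of length `r` of `0, +1, -1, +2, -2, ...`. -/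
noncomputable def seg (p r : ℕ) : Finset (ZMod p) := (Finset.range r).image (plusSeq p)

lemma sum_seg {M : Type*} [AddCommMonoid M] {r : ℕ} (hr : r ≤ p) (F : ZMod p → M) :
    ∑ x ∈ seg p r, F x = ∑ i ∈ Finset.range r, F (plusSeq p i) := by
  refine Finset.sum_image fun i hi j hj h => ?_
  rw [Finset.mem_coe, Finset.mem_range] at hi hj
  exact plusSeq_injOn (by omega) (by omega) h

lemma card_seg {r : ℕ} (hr : r ≤ p) : (seg p r).card = r := by
  rw [Finset.card_eq_sum_ones, sum_seg hr]
  simp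

lemma seg_self [NeZero p] : seg p p = Finset.univ :=
  Finset.eq_univ_of_card _ (by rw [card_seg le_rfl, ZMod.card])

lemma exists_plusSeq_eq [NeZero p] (z : ZMod p) : ∃ i < p, plusSeq p i = z := by
  have h : z ∈ seg p p := by rw [seg_self]; exact Finset.mem_univ z
  simpa only [seg, Finset.mem_image, Finset.mem_range] using h

lemma sum_plusSeq [NeZero p] {M : Type*} [AddCommMonoid M] (F : ZMod p → M) :
    ∑ i ∈ Finset.range p, F (plusSeq p i) = ∑ x, F x := by
  rw [← sum_seg le_rfl, seg_self]

lemma plusSeq_mem_seg {i r : ℕ} (hi : i < p) (hr : r ≤ p) : plusSeq p i ∈ seg p r ↔ i < r := by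
  simp only [seg, Finset.mem_image, Finset.mem_range]
  exact ⟨fun ⟨j, hj, h⟩ => plusSeq_injOn (by omega) hi h ▸ hj, fun h => ⟨i, h, rfl⟩⟩

lemma mem_seg {r : ℕ} {z : ZMod p} :
    z ∈ seg p r ↔ ∃ u : ℤ, -(r : ℤ) < 2 * u ∧ 2 * u ≤ r ∧ (u : ZMod p) = z := by
  simp only [seg, Finset.mem_image, Finset.mem_range, plusSeq_eq_intCast]
  constructor
  · rintro ⟨n, hn, rfl⟩
    refine ⟨plusInt n, ?_, ?_, rfl⟩ <;> unfold plusInt <;> split_ifs <;> omega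
  · rintro ⟨u, h₁, h₂, rfl⟩
    refine ⟨if 0 < u then (2 * u - 1).toNat else (-2 * u).toNat, ?_, ?_⟩
    · split_ifs <;> omega
    · congr 1
      unfold plusInt
      split_ifs <;> omega

lemma seg_eq_ivl {r : ℕ} : seg p r = ivl (-((((r - 1) / 2 : ℕ) : ℤ) : ZMod p)) r := by
  ext z
  simp only [mem_seg, ivl, Finset.mem_image, Finset.mem_range]
  constructor
  · rintro ⟨u, h₁, h₂, rfl⟩
    obtain ⟨m, hm⟩ := Int.eq_ofNat_of_zero_le (show 0 ≤ u + ((r - 1) / 2 : ℕ) by omega)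
    refine ⟨m, by omega, ?_⟩
    rw [← Int.cast_natCast m, ← hm, Int.cast_add]
    simp
  · rintro ⟨i, hi, rfl⟩
    exact ⟨i - ((r - 1) / 2 : ℕ), by omega, by omega, by
      rw [Int.cast_sub, Int.cast_natCast]; ring⟩

lemma image_neg_seg {r : ℕ} :
    (seg p r).image Neg.neg = ivl (-(((r / 2 : ℕ) : ℤ) : ZMod p)) r := by
  ext z
  simp only [mem_seg, ivl, Finset.mem_image, Finset.mem_range]
  constructor
  · rintro ⟨_, ⟨u, h₁, h₂, rfl⟩, rfl⟩
    obtain ⟨m, hm⟩ := Int.eq_ofNat_of_zero_le (show 0 ≤ -u + (r / 2 : ℕ) by omega)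
    refine ⟨m, by omega, ?_⟩
    rw [← Int.cast_natCast m, ← hm, Int.cast_add]
    simp
  · rintro ⟨i, hi, rfl⟩
    exact ⟨_, ⟨(r / 2 : ℕ) - i, by omega, by omega, rfl⟩, by
      rw [Int.cast_sub, Int.cast_natCast i]; ring⟩

lemma PlusAntitone.le {f : ZMod p → ℝ} (hf : PlusAntitone f) {i j : ℕ} (hij : i ≤ j)
    (hj : j < p) : f (plusSeq p j) ≤ f (plusSeq p i) := by
  induction j, hij using Nat.le_induction with
  | base => exact le_rfl
  | succ j hij ih => exact (hf j hj).trans (ih (by omega))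

/-- Among all pairs of sets of given cardinalities, intervals have the largest representation
function in the sense of majorization. -/
lemma sum_rep_le_sum_seg [Fact p.Prime] {A B I J : Finset (ZMod p)} {α β : ZMod p} {a b : ℕ}
    (hA : A.card = a) (hB : B.card = b) (hI : I = ivl α a) (hJ : J = ivl β b)
    (hanti : PlusAntitone fun x => (rep I J x : ℝ)) (T : Finset (ZMod p)) :
    ∑ x ∈ T, rep A B x ≤ ∑ x ∈ seg p T.card, rep I J x := by
  have card_le : ∀ S : Finset (ZMod p), S.card ≤ p := fun S =>
    (Finset.card_le_univ S).trans_eq (ZMod.card p)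
  have ha : a ≤ p := hA ▸ card_le A
  have hb : b ≤ p := hB ▸ card_le B
  have hIc : I.card = a := hI ▸ card_ivl α ha
  have hJc : J.card = b := hJ ▸ card_ivl β hb
  rcases Nat.eq_zero_or_pos T.card with hT | hT
  · simp [Finset.card_eq_zero.mp hT]
  set r := T.card with hr
  have hrp : r ≤ p := card_le T
  set t := rep I J (plusSeq p (r - 1)) with ht
  have hta : t ≤ a := hIc ▸ rep_le_left _ _ _
  have htb : t ≤ b := hJc ▸ rep_le_right _ _ _
  have split : ∀ u : ZMod p → ℕ, ∑ x, u x = ∑ x, min t (u x) + ∑ x, (u x - t) := by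
    intro u
    rw [← Finset.sum_add_distrib]
    exact Finset.sum_congr rfl fun x _ => by omega
  have hupper : ∑ x ∈ T, rep A B x ≤ r * t + ∑ x, (rep A B x - t) := by
    calc ∑ x ∈ T, rep A B x ≤ ∑ x ∈ T, (t + (rep A B x - t)) :=
          Finset.sum_le_sum fun x _ => by omega
      _ = r * t + ∑ x ∈ T, (rep A B x - t) := by
          rw [Finset.sum_add_distrib, Finset.sum_const, smul_eq_mul]
      _ ≤ _ := Nat.add_le_add_left
          (Finset.sum_le_sum_of_subset (Finset.subset_univ T)) _
  have hlower : ∑ x ∈ seg p r, rep I J x = r * t + ∑ x, (rep I J x - t) := by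
    have h₁ : ∀ x ∈ seg p r, rep I J x = t + (rep I J x - t) := by
      intro x hx
      obtain ⟨i, hi, rfl⟩ := Finset.mem_image.mp hx
      rw [Finset.mem_range] at hi
      have := Nat.cast_le.mp (hanti.le (show i ≤ r - 1 by omega) (by omega))
      omega
    have h₂ : ∀ x ∉ seg p r, rep I J x - t = 0 := by
      intro x hx
      obtain ⟨i, hi, rfl⟩ := exists_plusSeq_eq x
      rw [plusSeq_mem_seg hi hrp] at hx
      have := Nat.cast_le.mp (hanti.le (show r - 1 ≤ i by omega) hi)
      omega
    rw [Finset.sum_congr rfl h₁, Finset.sum_add_distrib, Finset.sum_const, smul_eq_mul,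
      card_seg hrp, Finset.sum_subset (Finset.subset_univ _) fun x _ hx => h₂ x hx]
  have e₁ := split (rep A B)
  have e₂ := split (rep I J)
  rw [sum_rep, hA, hB] at e₁
  rw [sum_rep, hIc, hJc] at e₂
  have hP := pollard A B t (hA ▸ hta) (hB ▸ htb)
  have hQ := sum_min_rep_ivl_le α β ha hb hta htb
  rw [hA, hB] at hP
  rw [← hI, ← hJ] at hQ
  omega

lemma sum_mul_le_sum_mul_of_partial_sums {u v d : ℕ → ℝ} {n : ℕ}
    (hd : ∀ i, i + 1 < n → d (i + 1) ≤ d i) (hd₀ : ∀ i < n, 0 ≤ d i)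
    (h : ∀ k ≤ n, ∑ i ∈ Finset.range k, u i ≤ ∑ i ∈ Finset.range k, v i) :
    ∑ i ∈ Finset.range n, u i * d i ≤ ∑ i ∈ Finset.range n, v i * d i := by
  have key : ∀ m, m + 1 ≤ n →
      d m * (∑ i ∈ Finset.range (m + 1), v i - ∑ i ∈ Finset.range (m + 1), u i) ≤
        ∑ i ∈ Finset.range (m + 1), v i * d i - ∑ i ∈ Finset.range (m + 1), u i * d i := by
    intro m hm
    induction m with
    | zero => simp; linarith
    | succ m ih =>
      have h₁ := ih (by omega)
      have h₂ := mul_le_mul_of_nonneg_right (hd m (by omega))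
        (sub_nonneg.mpr (h (m + 1) (by omega)))
      rw [Finset.sum_range_succ v, Finset.sum_range_succ u,
        Finset.sum_range_succ _ (m + 1), Finset.sum_range_succ _ (m + 1)]
      linarith
  cases n with
  | zero => simp
  | succ m =>
    have h₁ := mul_nonneg (hd₀ m (by omega)) (sub_nonneg.mpr (h (m + 1) le_rfl))
    linarith [key m le_rfl]

lemma exists_perm_plusAntitone [NeZero p] (w : ZMod p → ℝ) :
    ∃ σ : Equiv.Perm (ZMod p), PlusAntitone (w ∘ σ) := by
  have hbij : Function.Bijective fun i : Fin p => plusSeq p i := by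
    refine ⟨fun i j h => Fin.ext (plusSeq_injOn i.2 j.2 h), fun z => ?_⟩
    obtain ⟨i, hi, h⟩ := exists_plusSeq_eq z
    exact ⟨⟨i, hi⟩, h⟩
  set e := Equiv.ofBijective _ hbij
  set τ := Tuple.sort fun i : Fin p => -w (e i)
  refine ⟨(e.symm.trans τ).trans e, fun n hn => ?_⟩
  have hmono := Tuple.monotone_sort (fun i : Fin p => -w (e i))
    (show (⟨n, by omega⟩ : Fin p) ≤ ⟨n + 1, hn⟩ from Nat.le_succ n)
  have hP : ∀ i (hi : i < p), e.symm (plusSeq p i) = ⟨i, hi⟩ := fun i hi =>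
    e.symm_apply_eq.mpr rfl
  simp only [Function.comp_apply, Equiv.trans_apply, hP n (by omega), hP (n + 1) hn]
  simpa using hmono

/-- `g` is majorized by `G`, and `G` is nonnegative and nonincreasing along
`0, +1, -1, +2, -2, ...`. -/
structure Dom [NeZero p] (g G : ZMod p → ℝ) : Prop where
  nonneg : ∀ x, 0 ≤ G x
  anti : PlusAntitone G
  sum_le : ∀ T : Finset (ZMod p), ∑ x ∈ T, g x ≤ ∑ x ∈ seg p T.card, G x
  total : ∑ x, g x = ∑ x, G x

lemma Dom.sum_mul_le [NeZero p] {g G w W : ZMod p → ℝ} (hg : Dom g G) (hw₀ : ∀ x, 0 ≤ w x)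
    (hw : ∀ T : Finset (ZMod p), ∑ x ∈ T, w x ≤ ∑ x ∈ seg p T.card, W x) :
    ∑ x, g x * w x ≤ ∑ x, G x * W x := by
  obtain ⟨σ, hσ⟩ := exists_perm_plusAntitone w
  have partial_le : ∀ {u U : ZMod p → ℝ},
      (∀ T : Finset (ZMod p), ∑ x ∈ T, u x ≤ ∑ x ∈ seg p T.card, U x) → ∀ k ≤ p,
      ∑ i ∈ Finset.range k, u (σ (plusSeq p i)) ≤ ∑ i ∈ Finset.range k, U (plusSeq p i) := by
    intro u U h k hk
    have := h ((seg p k).map σ.toEmbedding)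
    rw [Finset.card_map, card_seg hk, Finset.sum_map, sum_seg hk, sum_seg hk] at this
    exact this
  calc ∑ x, g x * w x = ∑ x, g (σ x) * w (σ x) := (Equiv.sum_comp σ fun x => g x * w x).symm
    _ = ∑ i ∈ Finset.range p, g (σ (plusSeq p i)) * w (σ (plusSeq p i)) :=
      (sum_plusSeq fun x => g (σ x) * w (σ x)).symm
    _ ≤ ∑ i ∈ Finset.range p, G (plusSeq p i) * w (σ (plusSeq p i)) :=
      sum_mul_le_sum_mul_of_partial_sums hσ (fun _ _ => hw₀ _) (partial_le hg.sum_le)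
    _ = ∑ i ∈ Finset.range p, w (σ (plusSeq p i)) * G (plusSeq p i) := by
      simp_rw [mul_comm]
    _ ≤ ∑ i ∈ Finset.range p, W (plusSeq p i) * G (plusSeq p i) :=
      sum_mul_le_sum_mul_of_partial_sums hg.anti (fun _ _ => hg.nonneg _) (partial_le hw)
    _ = ∑ x, G x * W x := by
      rw [sum_plusSeq fun x => W x * G x]
      simp_rw [mul_comm]

/-- The kernel `1_{κ x y ∈ seg p k}` is symmetric, preserves monotonicity along
`0, +1, -1, +2, -2, ...`, and its partial sums over segments count representations by
intervals. -/
structure GoodKernel [NeZero p] (κ : ZMod p → ZMod p → ZMod p) (k : ℕ) : Prop where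
  symm : ∀ x y, κ x y ∈ seg p k → κ y x ∈ seg p k
  anti : ∀ G : ZMod p → ℝ, PlusAntitone G →
    PlusAntitone fun x => ∑ y, G y * if κ x y ∈ seg p k then 1 else 0
  interval : ∀ r : ℕ, ∃ (I : Finset (ZMod p)) (α : ZMod p), I = ivl α r ∧
    ∀ y, ((seg p r).filter fun x => κ x y ∈ seg p k).card = rep I (seg p k) y

lemma plusAntitone_indicator_seg {r : ℕ} (hr : r ≤ p) :
    PlusAntitone fun x : ZMod p => if x ∈ seg p r then (1 : ℝ) else 0 := by
  intro n hn
  simp only [plusSeq_mem_seg hn hr, plusSeq_mem_seg (show n < p by omega) hr]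
  split_ifs <;> first | omega | norm_num

lemma Dom.sum_conv_indicator_le [Fact p.Prime] {g G : ZMod p → ℝ} (hD : Dom g G)
    {κ : ZMod p → ZMod p → ZMod p} {k : ℕ} (hκ : GoodKernel κ k) {B : Finset (ZMod p)}
    (hB : B.card = k) (S : Finset (ZMod p)) :
    ∑ x ∈ S, ∑ y, g y * (if x - y ∈ B then 1 else 0) ≤
      ∑ x ∈ seg p S.card, ∑ y, G y * (if κ x y ∈ seg p k then 1 else 0) := by
  have hSp : S.card ≤ p := (Finset.card_le_univ S).trans_eq (ZMod.card p)
  obtain ⟨I, α, hI, hrep⟩ := hκ.interval S.card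
  have hl : ∀ y, ∑ x ∈ S, (if x - y ∈ B then (1 : ℝ) else 0) = rep S (B.image Neg.neg) y := by
    intro y
    rw [Finset.sum_boole, rep]
    congr 2
    ext x
    simp only [Finset.mem_filter, Finset.mem_image, and_congr_right_iff]
    intro _
    exact ⟨fun h => ⟨_, h, neg_sub x y⟩, fun ⟨b, hb, h⟩ => by
      rwa [← neg_sub, ← h, neg_neg]⟩
  have hr : ∀ y, ∑ x ∈ seg p S.card, (if κ x y ∈ seg p k then (1 : ℝ) else 0) =
      rep I (seg p k) y := by
    intro y
    rw [Finset.sum_boole, ← hrep]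
  rw [Finset.sum_comm, Finset.sum_comm (s := seg p S.card)]
  simp_rw [← Finset.mul_sum, hl, hr]
  refine hD.sum_mul_le (fun _ => Nat.cast_nonneg _) fun T => ?_
  have hanti : PlusAntitone fun y => (rep I (seg p k) y : ℝ) := by
    convert hκ.anti _ (plusAntitone_indicator_seg hSp) using 2 with y
    rw [← hr, ← Finset.sum_filter_add_sum_filter_not Finset.univ (· ∈ seg p S.card)]
    rw [Finset.filter_univ_mem, Finset.sum_eq_zero (s := Finset.filter _ _) (by simp_all),
      add_zero]
    refine Finset.sum_congr rfl fun x hx => ?_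
    rw [if_pos hx, one_mul]
    exact if_congr ⟨hκ.symm x y, hκ.symm y x⟩ rfl rfl
  exact_mod_cast sum_rep_le_sum_seg rfl
    ((Finset.card_image_of_injective _ neg_injective).trans hB) hI seg_eq_ivl hanti T

lemma exists_layer_cake [NeZero p] {B : ZMod p → ℝ} (hB₀ : ∀ x, 0 ≤ B x)
    (hB : PlusAntitone B) : ∃ c : ℕ → ℝ, (∀ k < p, 0 ≤ c k) ∧
      (∀ k, k + 1 < p → B (plusSeq p (k + 1)) = B (plusSeq p k) → c k = 0) ∧
      ∀ z, B z = ∑ k ∈ Finset.range p, c k * if z ∈ seg p (k + 1) then 1 else 0 := by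
  set D : ℕ → ℝ := fun k => if k < p then B (plusSeq p k) else 0 with hD
  refine ⟨fun k => D k - D (k + 1), fun k hk => ?_, fun k hk h => ?_, fun z => ?_⟩
  · simp only [hD, if_pos hk]
    split_ifs with h
    · exact sub_nonneg.mpr (hB k h)
    · simpa using hB₀ _
  · simp only [hD, if_pos hk, if_pos (show k < p by omega), h, sub_self]
  · obtain ⟨i, hi, rfl⟩ := exists_plusSeq_eq z
    have : ∀ k ∈ Finset.range p, (D k - D (k + 1)) *
        (if plusSeq p i ∈ seg p (k + 1) then 1 else 0) =
        if i ≤ k then D k - D (k + 1) else 0 := by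
      intro k hk
      rw [Finset.mem_range] at hk
      rw [mul_ite, mul_one, mul_zero]
      exact if_congr (by rw [plusSeq_mem_seg hi (by omega)]; omega) rfl rfl
    rw [Finset.sum_congr rfl this, ← Finset.sum_filter]
    have hIco : (Finset.range p).filter (fun k => i ≤ k) = Finset.Ico i p := by
      ext k; simp; omega
    have htel := Finset.sum_Ico_sub D hi.le
    have hneg : ∑ k ∈ Finset.Ico i p, (D k - D (k + 1)) =
        -∑ k ∈ Finset.Ico i p, (D (k + 1) - D k) := by
      rw [← Finset.sum_neg_distrib]
      exact Finset.sum_congr rfl fun _ _ => by ring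
    rw [hIco, hneg, htel]
    simp [hD, hi]

lemma Dom.conv_rearr [Fact p.Prime] {g G b B : ZMod p → ℝ} (hD : Dom g G) (hb : ∀ x, 0 ≤ b x)
    (hB : IsPlusRearr b B) {κ : ZMod p → ZMod p → ZMod p}
    (hκ : ∀ y, Function.Bijective fun x => κ x y)
    (hgood : ∀ k < p, GoodKernel κ (k + 1) ∨
      k + 1 < p ∧ B (plusSeq p (k + 1)) = B (plusSeq p k)) :
    Dom (conv g b) fun x => ∑ y, G y * B (κ x y) := by
  obtain ⟨⟨σ, rfl⟩, hanti⟩ := hB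
  have hB₀ : ∀ x, 0 ≤ (b ∘ σ) x := fun x => hb _
  obtain ⟨c, hc₀, hc, hlayer⟩ := exists_layer_cake hB₀ hanti
  have hG' : ∀ x, ∑ y, G y * (b ∘ σ) (κ x y) = ∑ k ∈ Finset.range p,
      c k * ∑ y, G y * if κ x y ∈ seg p (k + 1) then 1 else 0 := by
    intro x
    simp_rw [hlayer, Finset.mul_sum]
    rw [Finset.sum_comm]
    exact Finset.sum_congr rfl fun _ _ => Finset.sum_congr rfl fun _ _ => by ring
  have hb' : ∀ z, b z = ∑ k ∈ Finset.range p,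
      c k * if z ∈ (seg p (k + 1)).map σ.toEmbedding then 1 else 0 := by
    intro z
    have h := hlayer (σ.symm z)
    rw [Function.comp_apply, σ.apply_symm_apply] at h
    rw [h]
    simp only [Finset.mem_map_equiv]
  have hg' : ∀ x, conv g b x = ∑ k ∈ Finset.range p,
      c k * ∑ y, g y * if x - y ∈ (seg p (k + 1)).map σ.toEmbedding then 1 else 0 := by
    intro x
    simp_rw [conv, hb', Finset.mul_sum]
    rw [Finset.sum_comm]
    exact Finset.sum_congr rfl fun _ _ => Finset.sum_congr rfl fun _ _ => by ring
  refine ⟨fun x => Finset.sum_nonneg fun y _ => mul_nonneg (hD.nonneg y) (hB₀ _), ?_, ?_, ?_⟩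
  · intro n hn
    simp only [hG']
    refine Finset.sum_le_sum fun k hk => ?_
    rw [Finset.mem_range] at hk
    rcases hgood k hk with h | ⟨h, h'⟩
    · exact mul_le_mul_of_nonneg_left (h.anti G hD.anti n hn) (hc₀ k hk)
    · simp [hc k h h']
  · intro T
    simp only [hG', hg']
    rw [Finset.sum_comm, Finset.sum_comm (s := seg p T.card)]
    simp_rw [← Finset.mul_sum]
    refine Finset.sum_le_sum fun k hk => ?_
    rw [Finset.mem_range] at hk
    rcases hgood k hk with h | ⟨h, h'⟩
    · refine mul_le_mul_of_nonneg_left (hD.sum_conv_indicator_le h ?_ T) (hc₀ k hk)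
      rw [Finset.card_map, card_seg hk]
    · simp [hc k h h']
  · simp only [conv]
    rw [Finset.sum_comm, Finset.sum_comm (s := Finset.univ) (t := Finset.univ)
      (f := fun x y => G y * (b ∘ σ) (κ x y))]
    simp_rw [← Finset.mul_sum]
    have h₁ : ∀ y, ∑ x, b (x - y) = ∑ x, b x := fun y => Equiv.sum_comp (Equiv.subRight y) b
    have h₂ : ∀ y, ∑ x, (b ∘ σ) (κ x y) = ∑ x, b x := fun y =>
      ((hκ y).sum_comp (b ∘ σ)).trans (Equiv.sum_comp σ b)
    simp_rw [h₁, h₂, ← Finset.sum_mul, hD.total]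

lemma plusSeq_succ (n : ℕ) :
    plusSeq p (n + 1) = (((n + 1) % 2 : ℕ) : ZMod p) - plusSeq p n := by
  simp only [plusSeq_eq_intCast, ← Int.cast_natCast (R := ZMod p) ((n + 1) % 2), ← Int.cast_sub]
  congr 1
  unfold plusInt
  split_ifs <;> omega

lemma sum_mul_kernel_reflect_le [NeZero p] {G : ZMod p → ℝ} (hG : PlusAntitone G)
    (K K' : ZMod p → ℝ) (c : ℕ) (hK : ∀ y, K' y = K ((c % 2 : ℕ) - y))
    (hpos : ∀ m, m + 1 < p → (m + c) % 2 = 1 → K' (plusSeq p m) ≤ K (plusSeq p m)) :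
    ∑ y, G y * K' y ≤ ∑ y, G y * K y := by
  set ρ : ZMod p → ZMod p := fun y => ((c % 2 : ℕ) : ZMod p) - y with hρ
  have hρρ : ∀ y, ρ (ρ y) = y := fun y => sub_sub_cancel _ _
  have hsucc : ∀ m, (m + c) % 2 = 1 → plusSeq p (m + 1) = ρ (plusSeq p m) := by
    intro m hm
    rw [plusSeq_succ, show (m + 1) % 2 = c % 2 by omega]
  have hterm : ∀ y, 0 ≤ (G y - G (ρ y)) * (K y - K' y) := by
    have half : ∀ m, m + 1 < p → (m + c) % 2 = 1 →
        0 ≤ (G (plusSeq p m) - G (ρ (plusSeq p m))) * (K (plusSeq p m) - K' (plusSeq p m)) :=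
      fun m hm hmc => mul_nonneg (sub_nonneg.mpr (hsucc m hmc ▸ hG m hm))
        (sub_nonneg.mpr (hpos m hm hmc))
    intro y
    obtain ⟨i, hi, rfl⟩ := exists_plusSeq_eq y
    by_cases hic : (i + c) % 2 = 1
    · by_cases hip : i + 1 < p
      · exact half i hip hic
      · have : ρ (plusSeq p i) = plusSeq p i := by
          rw [← hsucc i hic, plusSeq_eq_intCast, plusSeq_eq_intCast, intCast_eq_iff]
          refine ⟨if i % 2 = 0 then -1 else 1, ?_⟩
          unfold plusInt
          split_ifs <;> omega
        simp [this]
    · cases i with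
      | zero =>
        have : ρ (plusSeq p 0) = plusSeq p 0 := by
          have hc : c % 2 = 0 := by omega
          simp [hρ, hc, plusSeq]
        simp [this]
      | succ j =>
        have hj : (j + c) % 2 = 1 := by omega
        have e₁ : K' (plusSeq p j) = K (ρ (plusSeq p j)) := hK _
        have e₂ : K' (ρ (plusSeq p j)) = K (plusSeq p j) :=
          (hK _).trans (congrArg K (hρρ _))
        have := half j hi hj
        rw [hsucc j hj, hρρ, e₂]
        rw [e₁] at this
        linarith
  have hsum : ∀ F : ZMod p → ℝ, ∑ y, F (ρ y) = ∑ y, F y := fun F =>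
    Equiv.sum_comp (Equiv.subLeft ((c % 2 : ℕ) : ZMod p)) F
  have h₁ := hsum fun y => G y * K y
  have h₂ := hsum fun y => G y * K' y
  have h₃ := Finset.sum_nonneg fun y (_ : y ∈ Finset.univ) => hterm y
  have h₄ : ∀ y, (G y - G (ρ y)) * (K y - K' y) =
      G y * K y - G y * K' y + (G (ρ y) * K (ρ y) - G (ρ y) * K' (ρ y)) := by
    intro y
    have e₁ : K' y = K (ρ y) := hK y
    have e₂ : K' (ρ y) = K y := (hK _).trans (congrArg K (hρρ y))
    rw [e₁, e₂]
    ring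
  simp_rw [h₄, Finset.sum_add_distrib, Finset.sum_sub_distrib] at h₃
  linarith

lemma neg_mem_seg_of_odd {k : ℕ} (hk : k % 2 = 1) {z : ZMod p} (hz : z ∈ seg p k) :
    -z ∈ seg p k := by
  obtain ⟨u, h₁, h₂, rfl⟩ := mem_seg.mp hz
  exact mem_seg.mpr ⟨-u, by omega, by omega, Int.cast_neg u⟩

lemma one_sub_mem_seg_of_even {k : ℕ} (hk : k % 2 = 0) {z : ZMod p} (hz : z ∈ seg p k) :
    1 - z ∈ seg p k := by
  obtain ⟨u, h₁, h₂, rfl⟩ := mem_seg.mp hz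
  exact mem_seg.mpr ⟨1 - u, by omega, by omega, by push_cast; ring⟩

lemma interval_sub (k r : ℕ) : ∃ (I : Finset (ZMod p)) (α : ZMod p), I = ivl α r ∧
    ∀ y, ((seg p r).filter fun x => y - x ∈ seg p k).card = rep I (seg p k) y :=
  ⟨_, _, seg_eq_ivl, fun _ => rfl⟩

lemma interval_add (k r : ℕ) : ∃ (I : Finset (ZMod p)) (α : ZMod p), I = ivl α r ∧
    ∀ y, ((seg p r).filter fun x => x + y ∈ seg p k).card = rep I (seg p k) y := by
  refine ⟨_, _, image_neg_seg, fun y => ?_⟩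
  rw [rep, Finset.filter_image, Finset.card_image_of_injective _ neg_injective]
  congr 1
  ext x
  simp [add_comm]

lemma goodKernel_of_eq [NeZero p] {κ : ZMod p → ZMod p → ZMod p} {k : ℕ} (hk : k = p)
    (h : ∀ r : ℕ, ∃ (I : Finset (ZMod p)) (α : ZMod p), I = ivl α r ∧
      ∀ y, ((seg p r).filter fun x => κ x y ∈ seg p k).card = rep I (seg p k) y) :
    GoodKernel κ k := by
  have huniv : seg p k = Finset.univ := by rw [hk, seg_self]
  exact ⟨by simp [huniv], fun G _ n _ => by simp [huniv], h⟩

lemma ite_le_ite_of_imp {P Q : Prop} [Decidable P] [Decidable Q] (h : P → Q) :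
    (if P then (1 : ℝ) else 0) ≤ if Q then 1 else 0 := by
  split_ifs <;> simp_all

lemma intCast_mem_seg {k : ℕ} {v : ℤ} : (v : ZMod p) ∈ seg p k ↔
    ∃ q : ℤ, -(k : ℤ) < 2 * (v - p * q) ∧ 2 * (v - p * q) ≤ k := by
  rw [mem_seg]
  constructor
  · rintro ⟨u, h₁, h₂, h⟩
    obtain ⟨q, rfl⟩ := (intCast_eq_iff u v).mp h
    exact ⟨q, by linarith, by linarith⟩
  · rintro ⟨q, h₁, h₂⟩
    exact ⟨_, h₁, h₂, by simp⟩

lemma bound_of_mul_bound {k v q : ℤ} (hp : 0 < p) (hk : k ≤ p) (hv : |v| ≤ p)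
    (h₁ : -k < 2 * (v - p * q)) (h₂ : 2 * (v - p * q) ≤ k) : q = -1 ∨ q = 0 ∨ q = 1 := by
  have := abs_le.mp hv
  have h₃ : -2 < q := by by_contra! h; nlinarith
  have h₄ : q < 2 := by by_contra! h; nlinarith
  omega

lemma goodKernel_sub_of_odd [NeZero p] {k : ℕ} (hkp : k ≤ p) (hk : k % 2 = 1) :
    GoodKernel (fun x y : ZMod p => y - x) k := by
  refine ⟨fun x y h => neg_sub y x ▸ neg_mem_seg_of_odd hk h, fun G hG n hn => ?_, interval_sub k⟩
  refine sum_mul_kernel_reflect_le hG _ _ (n + 1) (fun y => ?_) fun m hm hmn => ?_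
  · refine if_congr ⟨fun h => ?_, fun h => ?_⟩ rfl rfl <;> rw [plusSeq_succ] at * <;>
      convert neg_mem_seg_of_odd hk h using 1 <;> ring
  · refine ite_le_ite_of_imp fun h => ?_
    simp only [plusSeq_eq_intCast, ← Int.cast_sub] at h ⊢
    rw [intCast_mem_seg] at h ⊢
    obtain ⟨q, h₁, h₂⟩ := h
    refine ⟨0, ?_⟩
    have hv : |plusInt m - plusInt (n + 1)| ≤ p := by
      unfold plusInt; rw [abs_le]; split_ifs <;> omega
    rcases bound_of_mul_bound (by omega) (by omega) hv h₁ h₂ with rfl | rfl | rfl <;>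
    · unfold plusInt at h₁ h₂ ⊢
      split_ifs at h₁ h₂ ⊢ <;> omega

lemma goodKernel_add_of_even [NeZero p] {k : ℕ} (hkp : k ≤ p) (hk : k % 2 = 0) :
    GoodKernel (fun x y : ZMod p => x + y) k := by
  refine ⟨fun x y h => add_comm x y ▸ h, fun G hG n hn => ?_, interval_add k⟩
  have hone : (((n + 1) % 2 : ℕ) : ZMod p) + ((n % 2 : ℕ) : ZMod p) = 1 := by
    rw [← Nat.cast_add, show (n + 1) % 2 + n % 2 = 1 by omega, Nat.cast_one]
  refine sum_mul_kernel_reflect_le hG _ _ n (fun y => ?_) fun m hm hmn => ?_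
  · refine if_congr ⟨fun h => ?_, fun h => ?_⟩ rfl rfl <;> rw [plusSeq_succ] at * <;>
      convert one_sub_mem_seg_of_even hk h using 1 <;> linear_combination hone
  · refine ite_le_ite_of_imp fun h => ?_
    simp only [plusSeq_eq_intCast, ← Int.cast_add] at h ⊢
    rw [intCast_mem_seg] at h ⊢
    obtain ⟨q, h₁, h₂⟩ := h
    refine ⟨0, ?_⟩
    have hv : |plusInt (n + 1) + plusInt m| ≤ p := by
      unfold plusInt; rw [abs_le]; split_ifs <;> omega
    rcases bound_of_mul_bound (by omega) (by omega) hv h₁ h₂ with rfl | rfl | rfl <;>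
    · unfold plusInt at h₁ h₂ ⊢
      split_ifs at h₁ h₂ ⊢ <;> omega

lemma PlusAntitone.sum_comp_perm_le [NeZero p] {F : ZMod p → ℝ} (hF : PlusAntitone F)
    (σ : Equiv.Perm (ZMod p)) (T : Finset (ZMod p)) :
    ∑ x ∈ T, F (σ x) ≤ ∑ x ∈ seg p T.card, F x := by
  have hr : T.card ≤ p := (Finset.card_le_univ T).trans_eq (ZMod.card p)
  rcases Nat.eq_zero_or_pos T.card with hT | hT
  · simp [Finset.card_eq_zero.mp hT, seg]
  set r := T.card
  set t := F (plusSeq p (r - 1))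
  have h₁ : ∀ x ∈ seg p r, max (F x - t) 0 = F x - t := by
    intro x hx
    obtain ⟨i, hi, rfl⟩ := Finset.mem_image.mp hx
    rw [Finset.mem_range] at hi
    exact max_eq_left (sub_nonneg.mpr (hF.le (by omega) (by omega)))
  have h₂ : ∀ x ∉ seg p r, max (F x - t) 0 = 0 := by
    intro x hx
    obtain ⟨i, hi, rfl⟩ := exists_plusSeq_eq x
    rw [plusSeq_mem_seg hi hr] at hx
    exact max_eq_right (sub_nonpos.mpr (hF.le (by omega) hi))
  have h₃ : ∑ x ∈ T, (F (σ x) - t) ≤ ∑ x ∈ seg p r, (F x - t) := by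
    calc ∑ x ∈ T, (F (σ x) - t) ≤ ∑ x ∈ T, max (F (σ x) - t) 0 :=
          Finset.sum_le_sum fun _ _ => le_max_left _ _
      _ ≤ ∑ x, max (F (σ x) - t) 0 :=
          Finset.sum_le_sum_of_subset_of_nonneg (Finset.subset_univ T)
            fun _ _ _ => le_max_right _ _
      _ = ∑ x, max (F x - t) 0 := Equiv.sum_comp σ fun x => max (F x - t) 0
      _ = ∑ x ∈ seg p r, (F x - t) := by
          rw [← Finset.sum_congr rfl h₁]
          exact (Finset.sum_subset (Finset.subset_univ _) fun x _ hx => h₂ x hx).symm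
  rw [Finset.sum_sub_distrib, Finset.sum_sub_distrib, Finset.sum_const, Finset.sum_const,
    card_seg hr] at h₃
  exact (sub_le_sub_iff_right _).mp h₃

lemma IsPlusRearr.dom [NeZero p] {f fp : ZMod p → ℝ} (h : IsPlusRearr f fp)
    (hf : ∀ x, 0 ≤ f x) : Dom f fp := by
  obtain ⟨⟨σ, rfl⟩, hanti⟩ := h
  refine ⟨fun x => hf _, hanti, fun T => ?_, (Equiv.sum_comp σ f).symm⟩
  simpa using PlusAntitone.sum_comp_perm_le hanti σ.symm T

lemma PlusAntitone.eq_of_comp_perm [NeZero p] {F F' : ZMod p → ℝ} (hF : PlusAntitone F)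
    (hF' : PlusAntitone F') {σ : Equiv.Perm (ZMod p)} (h : F' = F ∘ σ) : F' = F := by
  have hsum : ∀ r ≤ p, ∑ i ∈ Finset.range r, F' (plusSeq p i) =
      ∑ i ∈ Finset.range r, F (plusSeq p i) := by
    intro r hr
    rw [← sum_seg hr, ← sum_seg hr]
    refine le_antisymm ?_ ?_
    · have := hF.sum_comp_perm_le σ (seg p r)
      rw [card_seg hr] at this
      simpa only [h, Function.comp_apply] using this
    · have := hF'.sum_comp_perm_le σ.symm (seg p r)
      simp only [h, Function.comp_apply, σ.apply_symm_apply, card_seg hr] at this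
      simpa only [h, Function.comp_apply] using this
  funext z
  obtain ⟨i, hi, rfl⟩ := exists_plusSeq_eq z
  have h₁ := hsum (i + 1) hi
  rw [Finset.sum_range_succ, Finset.sum_range_succ, hsum i hi.le] at h₁
  exact add_left_cancel h₁

lemma IsMinusRearr.eq_comp_neg [NeZero p] {s sp sm : ZMod p → ℝ} (hp : IsPlusRearr s sp)
    (hm : IsMinusRearr s sm) (z : ZMod p) : sm (-z) = sp z := by
  obtain ⟨⟨σ, rfl⟩, hσ⟩ := hp
  obtain ⟨⟨τ, rfl⟩, hτ⟩ := hm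
  refine congrFun (PlusAntitone.eq_of_comp_perm (F' := fun z => (s ∘ τ) (-z)) hσ hτ
    (σ := ((Equiv.neg _).trans τ).trans σ.symm) ?_) z
  funext z
  simp

lemma Dom.conv_triangle [Fact p.Prime] {g G h hs : ZMod p → ℝ} (hD : Dom g G)
    (hh : ∀ x, 0 ≤ h x) (hr : IsPlusRearr h hs) (hsymm : ∀ z, hs (-z) = hs z) :
    Dom (conv g h) (conv G hs) := by
  have key := hD.conv_rearr hh hr (κ := fun x y => y - x) (fun y => (Equiv.subLeft y).bijective) ?_
  · convert key using 2 with x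
    simp only [conv]
    exact Finset.sum_congr rfl fun y _ => by rw [← hsymm, neg_sub]
  · intro k hk
    rcases Nat.mod_two_eq_zero_or_one k with h₀ | h₁
    · exact Or.inl (goodKernel_sub_of_odd hk (by omega))
    · rcases (show k + 1 ≤ p from hk).eq_or_lt with h | h
      · exact Or.inl (goodKernel_of_eq h (interval_sub _))
      · refine Or.inr ⟨h, ?_⟩
        rw [← hsymm (plusSeq p k), plusSeq_succ, show (k + 1) % 2 = 0 by omega, Nat.cast_zero,
          zero_sub]

lemma Dom.conv_square [Fact p.Prime] {g G s sp : ZMod p → ℝ} (hD : Dom g G)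
    (hs : ∀ x, 0 ≤ s x) (hr : IsPlusRearr s sp) (hsymm : ∀ z, sp (1 - z) = sp z) :
    Dom (conv g s) fun x => ∑ y, G y * sp (x + y) := by
  refine hD.conv_rearr hs hr (κ := fun x y => x + y) (fun y => (Equiv.addRight y).bijective) ?_
  intro k hk
  rcases Nat.mod_two_eq_zero_or_one k with h₀ | h₁
  · rcases (show k + 1 ≤ p from hk).eq_or_lt with h | h
    · exact Or.inl (goodKernel_of_eq h (interval_add _))
    · refine Or.inr ⟨h, ?_⟩
      rw [← hsymm (plusSeq p k), plusSeq_succ, show (k + 1) % 2 = 1 by omega, Nat.cast_one]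
  · exact Or.inl (goodKernel_add_of_even hk (by omega))

lemma conv_conv_eq [NeZero p] {G s t t' : ZMod p → ℝ} (hs : ∀ z, s (1 - z) = s z)
    (ht : ∀ z, t (z + 1) = t' z) (x : ZMod p) :
    conv (conv G s) t' x = ∑ y, (∑ z, G z * s (y + z)) * t (x + y) := by
  rw [conv, ← Equiv.sum_comp (Equiv.subLeft (1 : ZMod p))]
  refine Finset.sum_congr rfl fun y _ => ?_
  simp only [Equiv.subLeft_apply, conv]
  congr 1
  · refine Finset.sum_congr rfl fun z _ => ?_
    rw [← hs (y + z), sub_sub]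
  · rw [← ht]
    congr 1
    ring

lemma conv_assoc [NeZero p] (f g h : ZMod p → ℝ) : conv (conv f g) h = conv f (conv g h) := by
  funext x
  simp only [conv, Finset.sum_mul, Finset.mul_sum]
  rw [Finset.sum_comm]
  refine Finset.sum_congr rfl fun z _ => ?_
  rw [← Equiv.sum_comp (Equiv.addRight z)]
  refine Finset.sum_congr rfl fun y _ => ?_
  simp only [Equiv.coe_addRight, add_sub_cancel_right, mul_assoc]
  rw [show x - (y + z) = x - z - y by ring]

lemma conv_convList_nil [NeZero p] (f : ZMod p → ℝ) : conv f (convList []) = f := by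
  funext x
  simp only [conv, convList, List.foldr_nil, sub_eq_zero]
  simp

lemma convList_cons [NeZero p] (f : ZMod p → ℝ) (l : List (ZMod p → ℝ)) :
    convList (f :: l) = conv f (convList l) := rfl

lemma conv_convList_append [NeZero p] (f : ZMod p → ℝ) (l l' : List (ZMod p → ℝ)) :
    conv f (convList (l ++ l')) = conv (conv f (convList l)) (convList l') := by
  induction l generalizing f with
  | nil => rw [conv_convList_nil, List.nil_append]
  | cons a l ih =>
    rw [List.cons_append, convList_cons, convList_cons, ← conv_assoc, ← conv_assoc, ih]

lemma Dom.conv_triangle_list [Fact p.Prime] {n : ℕ} {g G : ZMod p → ℝ} (hD : Dom g G)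
    (h hs : Fin n → ZMod p → ℝ) (hh : ∀ j, IsPMF (h j))
    (hreg : ∀ j, IsPlusRearr (h j) (hs j) ∧ ∀ z, hs j (-z) = hs j z) :
    Dom (conv g (convList (List.ofFn h))) (conv G (convList (List.ofFn hs))) := by
  induction n generalizing g G with
  | zero => simpa only [List.ofFn_zero, conv_convList_nil] using hD
  | succ n ih =>
    rw [List.ofFn_succ, List.ofFn_succ, convList_cons, convList_cons, ← conv_assoc, ← conv_assoc]
    exact ih (hD.conv_triangle (hh 0).1 (hreg 0).1 (hreg 0).2) _ _ (fun j => hh j.succ)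
      fun j => hreg j.succ

lemma Dom.conv_square_list [Fact p.Prime] {m : ℕ} {g G : ZMod p → ℝ} (hD : Dom g G)
    (s sp sm : Fin (2 * m) → ZMod p → ℝ) (hs : ∀ j, IsPMF (s j))
    (hsreg : ∀ j, IsPlusRearr (s j) (sp j) ∧ IsMinusRearr (s j) (sm j) ∧
      ∀ z, sp j (z + 1) = sm j z) :
    Dom (conv g (convList (List.ofFn s)))
      (conv G (convList (List.ofFn fun j : Fin (2 * m) =>
        if (j : ℕ) % 2 = 0 then sp j else sm j))) := by
  have hsymm : ∀ j z, sp j (1 - z) = sp j z := by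
    intro j z
    obtain ⟨h₁, h₂, h₃⟩ := hsreg j
    rw [← h₂.eq_comp_neg h₁ z, ← h₃, neg_add_eq_sub]
  induction m generalizing g G with
  | zero =>
    change Dom (conv g (convList [])) (conv G (convList []))
    rwa [conv_convList_nil, conv_convList_nil]
  | succ m ih =>
    change Fin (2 * m + 1 + 1) → ZMod p → ℝ at s sp sm
    change Dom (conv g (convList (List.ofFn (n := 2 * m + 1 + 1) s)))
      (conv G (convList (List.ofFn fun j : Fin (2 * m + 1 + 1) =>
        if (j : ℕ) % 2 = 0 then sp j else sm j)))
    have key := ih (s := fun j => s j.succ.succ) (sp := fun j => sp j.succ.succ)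
      (sm := fun j => sm j.succ.succ)
      (((hD.conv_square (hs 0).1 (hsreg 0).1 (hsymm 0))).conv_square (hs 1).1 (hsreg 1).1
        (hsymm 1)) (fun j => hs j.succ.succ) (fun j => hsreg j.succ.succ)
      fun j => hsymm j.succ.succ
    rw [List.ofFn_succ, List.ofFn_succ, List.ofFn_succ, List.ofFn_succ, convList_cons,
      convList_cons, convList_cons, convList_cons, ← conv_assoc, ← conv_assoc, ← conv_assoc,
      ← conv_assoc]
    convert key using 2
    · rfl
    · funext x
      exact conv_conv_eq (hsymm 0) (hsreg 1).2.2 x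
    · congr 2
      funext j
      simp [add_assoc]

/-- Generalized rearrangement majorization: for a pmf `f`, `△`-regular pmfs
`h₁, ..., hₙ` and `□`-regular pmfs `s₁, ..., s_{2m}`,
`f ⋆ h₁ ⋆ ⋯ ⋆ hₙ ⋆ s₁ ⋆ ⋯ ⋆ s_{2m}` is majorized by
`f⁺ ⋆ h₁* ⋆ ⋯ ⋆ hₙ* ⋆ s₁⁺ ⋆ s₂⁻ ⋆ ⋯ ⋆ s_{2m-1}⁺ ⋆ s_{2m}⁻`. -/
theorem generalized_rearrangement_majorization (hp : p.Prime) [NeZero p] {n m : ℕ}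
    (f : ZMod p → ℝ) (hf : IsPMF f) (fp : ZMod p → ℝ) (hfp : IsPlusRearr f fp)
    (h hstar : Fin n → ZMod p → ℝ) (hh : ∀ j, IsPMF (h j))
    (hreg : ∀ j, IsPlusRearr (h j) (hstar j) ∧ ∀ z, hstar j (-z) = hstar j z)
    (s sp sm : Fin (2 * m) → ZMod p → ℝ) (hs : ∀ j, IsPMF (s j))
    (hsreg : ∀ j, IsPlusRearr (s j) (sp j) ∧ IsMinusRearr (s j) (sm j) ∧
      ∀ z, sp j (z + 1) = sm j z) :
    Maj (convList (f :: (List.ofFn h ++ List.ofFn s)))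
      (convList (fp :: (List.ofFn hstar ++
        List.ofFn (fun j : Fin (2 * m) => if (j : ℕ) % 2 = 0 then sp j else sm j)))) := by
  have : Fact p.Prime := ⟨hp⟩
  have key := ((hfp.dom hf.1).conv_triangle_list h hstar hh hreg).conv_square_list s sp sm hs hsreg
  rw [← conv_convList_append, ← conv_convList_append] at key
  exact ⟨fun T => ⟨seg p T.card, card_seg ((Finset.card_le_univ T).trans_eq (ZMod.card p)),
    key.sum_le T⟩, key.total⟩

end Paper
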